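/- If a sequent Γ ⇒ Δ is derivable in the sequent calculus Go_Seq extended with the cut rule, then Γ ⇒ Δ is provable in the non-well-founded sequent calculus Go_∞+cut. -/

import Mathlib

inductive Formula : Type
  | atom : ℕ → Formula
  | bot  : Formula
  | imp  : Formula → Formula → Formula
  | box  : Formula → Formula
deriving DecidableEq

def boxtimes (Γ : Multiset Formula) : Multiset Formula := Γ + Γ.map Formula.box

inductive GoSeq : Bool → Multiset Formula → Multiset Formula → Prop
  | ax (c) (Γ Δ : Multiset Formula) (A : Formula) : GoSeq c (A ::ₘ Γ) (A ::ₘ Δ)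
  | axBot (c) (Γ Δ : Multiset Formula) : GoSeq c (Formula.bot ::ₘ Γ) Δ
  | impL (c) (Γ Δ : Multiset Formula) (A B : Formula) :
      GoSeq c (B ::ₘ Γ) Δ → GoSeq c Γ (A ::ₘ Δ) → GoSeq c ((A.imp B) ::ₘ Γ) Δ
  | impR (c) (Γ Δ : Multiset Formula) (A B : Formula) :
      GoSeq c (A ::ₘ Γ) (B ::ₘ Δ) → GoSeq c Γ ((A.imp B) ::ₘ Δ)
  | boxGo (c) (Γ Δ Θ : Multiset Formula) (A : Formula) :
      GoSeq c ((Formula.box (A.imp (Formula.box A))) ::ₘ boxtimes Θ) {A} →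
      GoSeq c (Γ + Θ.map Formula.box) ((Formula.box A) ::ₘ Δ)
  | cut (Γ Δ : Multiset Formula) (A : Formula) :
      GoSeq true Γ (A ::ₘ Δ) → GoSeq true (A ::ₘ Γ) Δ → GoSeq true Γ Δ

inductive Frag : Bool → ℕ → Multiset Formula → Multiset Formula → Type
  | hole (c) (Γ Δ : Multiset Formula) : Frag c 0 Γ Δ
  | axP (c) (n) (Γ Δ : Multiset Formula) (p : ℕ) :
      Frag c (n+1) (Formula.atom p ::ₘ Γ) (Formula.atom p ::ₘ Δ)
  | axBot (c) (n) (Γ Δ : Multiset Formula) : Frag c (n+1) (Formula.bot ::ₘ Γ) Δ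
  | impL (c) (n) (Γ Δ : Multiset Formula) (A B : Formula) :
      Frag c (n+1) (B ::ₘ Γ) Δ → Frag c (n+1) Γ (A ::ₘ Δ) →
      Frag c (n+1) ((A.imp B) ::ₘ Γ) Δ
  | impR (c) (n) (Γ Δ : Multiset Formula) (A B : Formula) :
      Frag c (n+1) (A ::ₘ Γ) (B ::ₘ Δ) → Frag c (n+1) Γ ((A.imp B) ::ₘ Δ)
  | box (c) (n) (Γ Δ Θ : Multiset Formula) (l : List Formula) (h : l ≠ []) :
      Frag c (n+1) (boxtimes Θ) (boxtimes (↑l)) →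
      ((i : Fin l.length) → Frag c n (boxtimes Θ) {l.get i}) →
      Frag c (n+1) (Γ + Θ.map Formula.box) ((↑(l.map Formula.box) : Multiset Formula) + Δ)
  | cut (n) (Γ Δ : Multiset Formula) (A : Formula) :
      Frag true (n+1) Γ (A ::ₘ Δ) → Frag true (n+1) (A ::ₘ Γ) Δ → Frag true (n+1) Γ Δ

def Frag.trunc : ∀ {c : Bool} {n : ℕ} {Γ Δ : Multiset Formula}, Frag c (n+1) Γ Δ → Frag c n Γ Δ
  | c, 0, Γ, Δ, _ => .hole c Γ Δ
  | c, n+1, _, _, .axP _ _ Γ Δ p => .axP c n Γ Δ p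
  | c, n+1, _, _, .axBot _ _ Γ Δ => .axBot c n Γ Δ
  | c, n+1, _, _, .impL _ _ Γ Δ A B a b => .impL c n Γ Δ A B a.trunc b.trunc
  | c, n+1, _, _, .impR _ _ Γ Δ A B a => .impR c n Γ Δ A B a.trunc
  | c, n+1, _, _, .box _ _ Γ Δ Θ l h a bs => .box c n Γ Δ Θ l h a.trunc (fun i => (bs i).trunc)
  | _, n+1, _, _, .cut _ Γ Δ A a b => .cut n Γ Δ A a.trunc b.trunc

def Frag.height : ∀ {c : Bool} {n : ℕ} {Γ Δ : Multiset Formula}, Frag c n Γ Δ → ℕ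
  | _, _, _, _, .hole _ _ _ => 0
  | _, _, _, _, .axP _ _ _ _ _ => 0
  | _, _, _, _, .axBot _ _ _ _ => 0
  | _, _, _, _, .impL _ _ _ _ _ _ a b => max a.height b.height + 1
  | _, _, _, _, .impR _ _ _ _ _ _ a => a.height + 1
  | _, _, _, _, .box _ _ _ _ _ _ _ a bs =>
      max a.height (Finset.univ.sup fun i => (bs i).height) + 1
  | _, _, _, _, .cut _ _ _ _ a b => max a.height b.height + 1

def Frag.cutFree : ∀ {c : Bool} {n : ℕ} {Γ Δ : Multiset Formula}, Frag c n Γ Δ → Prop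
  | _, _, _, _, .hole _ _ _ => True
  | _, _, _, _, .axP _ _ _ _ _ => True
  | _, _, _, _, .axBot _ _ _ _ => True
  | _, _, _, _, .impL _ _ _ _ _ _ a b => a.cutFree ∧ b.cutFree
  | _, _, _, _, .impR _ _ _ _ _ _ a => a.cutFree
  | _, _, _, _, .box _ _ _ _ _ _ _ a bs => a.cutFree ∧ ∀ i, (bs i).cutFree
  | _, _, _, _, .cut _ _ _ _ _ _ => False

structure InfProof (c : Bool) (Γ Δ : Multiset Formula) : Type where
  frag : ∀ n : ℕ, Frag c n Γ Δ
  compat : ∀ n : ℕ, (frag (n+1)).trunc = frag n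

structure PP : Type where
  Γ : Multiset Formula
  Δ : Multiset Formula
  prf : InfProof true Γ Δ

def Sim : ℕ → PP → PP → Prop
  | 0, _, _ => True
  | n+1, π, τ => π.Γ = τ.Γ ∧ π.Δ = τ.Δ ∧ HEq (π.prf.frag (n+1)) (τ.prf.frag (n+1))

noncomputable def dP (π τ : PP) : ℝ :=
  sInf {r : ℝ | ∃ n : ℕ, Sim n π τ ∧ r = (1/2 : ℝ) ^ n}

def localHeight (π : PP) : ℕ := (π.prf.frag 1).height

def Pmem (n : ℕ) (π : PP) : Prop := (π.prf.frag n).cutFree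

/-- Finite derivations in `Go_∞+cut` in which the right premises of `(□)` are only required to
satisfy the predicate `P`. -/
inductive Deriv (P : Multiset Formula → Multiset Formula → Prop) :
    Multiset Formula → Multiset Formula → Type
  | axP (Γ Δ : Multiset Formula) (p : ℕ) : Deriv P (Formula.atom p ::ₘ Γ) (Formula.atom p ::ₘ Δ)
  | axBot (Γ Δ : Multiset Formula) : Deriv P (Formula.bot ::ₘ Γ) Δ
  | impL (Γ Δ : Multiset Formula) (A B : Formula) :
      Deriv P (B ::ₘ Γ) Δ → Deriv P Γ (A ::ₘ Δ) → Deriv P ((A.imp B) ::ₘ Γ) Δ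
  | impR (Γ Δ : Multiset Formula) (A B : Formula) :
      Deriv P (A ::ₘ Γ) (B ::ₘ Δ) → Deriv P Γ ((A.imp B) ::ₘ Δ)
  | box (Γ Δ Θ : Multiset Formula) (l : List Formula) (h : l ≠ []) :
      Deriv P (boxtimes Θ) (boxtimes (↑l)) →
      (∀ i : Fin l.length, P (boxtimes Θ) {l.get i}) →
      Deriv P (Γ + Θ.map Formula.box) ((↑(l.map Formula.box) : Multiset Formula) + Δ)
  | cut (Γ Δ : Multiset Formula) (A : Formula) :
      Deriv P Γ (A ::ₘ Δ) → Deriv P (A ::ₘ Γ) Δ → Deriv P Γ Δ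

namespace Deriv

variable {P Q : Multiset Formula → Multiset Formula → Prop} {Γ Δ Γ' Δ' Θ : Multiset Formula}
  {A B : Formula}

/-- The fragment of depth `n + 1` obtained by plugging fragments of depth `n` into the right
premises of a finite derivation. -/
def toFrag {n : ℕ} (g : ∀ Γ Δ, P Γ Δ → Frag true n Γ Δ) :
    ∀ {Γ Δ : Multiset Formula}, Deriv P Γ Δ → Frag true (n + 1) Γ Δ
  | _, _, .axP Γ Δ p => .axP _ n Γ Δ p
  | _, _, .axBot Γ Δ => .axBot _ n Γ Δ
  | _, _, .impL Γ Δ A B a b => .impL _ n Γ Δ A B (a.toFrag g) (b.toFrag g)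
  | _, _, .impR Γ Δ A B a => .impR _ n Γ Δ A B (a.toFrag g)
  | _, _, .box Γ Δ Θ l h a bs =>
      .box _ n Γ Δ Θ l h (a.toFrag g) (fun i => g _ _ (bs i))
  | _, _, .cut Γ Δ A a b => .cut n Γ Δ A (a.toFrag g) (b.toFrag g)

theorem trunc_toFrag {n : ℕ} {g : ∀ Γ Δ, P Γ Δ → Frag true (n + 1) Γ Δ}
    {g' : ∀ Γ Δ, P Γ Δ → Frag true n Γ Δ} (hg : ∀ Γ Δ h, (g Γ Δ h).trunc = g' Γ Δ h)
    (d : Deriv P Γ Δ) : (d.toFrag g).trunc = d.toFrag g' := by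
  induction d <;> simp_all [toFrag, Frag.trunc]

/-- The unravelling to depth `n` of a sequent in a set of sequents closed under backward
application of finite derivations. -/
def unravel (f : ∀ Γ Δ, P Γ Δ → Deriv P Γ Δ) : ∀ (n : ℕ) (Γ Δ), P Γ Δ → Frag true n Γ Δ
  | 0, Γ, Δ, _ => .hole _ Γ Δ
  | n + 1, Γ, Δ, h => (f Γ Δ h).toFrag (unravel f n)

theorem trunc_unravel (f : ∀ Γ Δ, P Γ Δ → Deriv P Γ Δ) (n : ℕ) (h : P Γ Δ) :
    (unravel f (n + 1) Γ Δ h).trunc = unravel f n Γ Δ h := by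
  induction n generalizing Γ Δ with
  | zero => simp [unravel, Frag.trunc]
  | succ n ih => exact trunc_toFrag (fun _ _ h => ih h) _

theorem mono (hPQ : ∀ Γ Δ, P Γ Δ → Q Γ Δ) (d : Deriv P Γ Δ) : Nonempty (Deriv Q Γ Δ) := by
  induction d with
  | axP Γ Δ p => exact ⟨.axP Γ Δ p⟩
  | axBot Γ Δ => exact ⟨.axBot Γ Δ⟩
  | impL Γ Δ A B _ _ iha ihb => exact iha.elim fun a => ihb.elim fun b => ⟨.impL Γ Δ A B a b⟩
  | impR Γ Δ A B _ ih => exact ih.map (.impR Γ Δ A B)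
  | box Γ Δ Θ l h _ bs ih =>
    exact ih.map fun a => .box Γ Δ Θ l h a fun i => hPQ _ _ (bs i)
  | cut Γ Δ A _ _ iha ihb => exact iha.elim fun a => ihb.elim fun b => ⟨.cut Γ Δ A a b⟩

theorem add_context (d : Deriv P Γ Δ) (Γ' Δ' : Multiset Formula) :
    Nonempty (Deriv P (Γ + Γ') (Δ + Δ')) := by
  induction d with
  | axP Γ Δ p => simpa only [Multiset.cons_add] using ⟨.axP (Γ + Γ') (Δ + Δ') p⟩
  | axBot Γ Δ => simpa only [Multiset.cons_add] using ⟨.axBot (Γ + Γ') (Δ + Δ')⟩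
  | impL Γ Δ A B _ _ iha ihb =>
    simp only [Multiset.cons_add] at iha ihb ⊢
    exact iha.elim fun a => ihb.elim fun b => ⟨.impL _ _ A B a b⟩
  | impR Γ Δ A B _ ih =>
    simp only [Multiset.cons_add] at ih ⊢
    exact ih.map (.impR _ _ A B)
  | box Γ Δ Θ l h a bs =>
    rw [add_right_comm, add_assoc _ Δ Δ']
    exact ⟨.box (Γ + Γ') (Δ + Δ') Θ l h a bs⟩
  | cut Γ Δ A _ _ iha ihb =>
    simp only [Multiset.cons_add] at iha ihb
    exact iha.elim fun a => ihb.elim fun b => ⟨.cut _ _ A a b⟩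

theorem weaken (d : Nonempty (Deriv P Γ Δ)) (hΓ : Γ ≤ Γ') (hΔ : Δ ≤ Δ') :
    Nonempty (Deriv P Γ' Δ') := by
  obtain ⟨Γ₀, rfl⟩ := Multiset.le_iff_exists_add.1 hΓ
  obtain ⟨Δ₀, rfl⟩ := Multiset.le_iff_exists_add.1 hΔ
  exact d.elim fun d => d.add_context _ _

theorem nonempty_impR (d : Nonempty (Deriv P (A ::ₘ Γ) (B ::ₘ Δ))) :
    Nonempty (Deriv P Γ (A.imp B ::ₘ Δ)) :=
  d.map (.impR Γ Δ A B)

theorem nonempty_cut (a : Nonempty (Deriv P Γ (A ::ₘ Δ))) (b : Nonempty (Deriv P (A ::ₘ Γ) Δ)) :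
    Nonempty (Deriv P Γ Δ) :=
  a.elim fun a => b.elim fun b => ⟨.cut Γ Δ A a b⟩

theorem nonempty_box (l : List Formula) (hl : l ≠ []) (hΓ : Θ.map Formula.box ≤ Γ)
    (hΔ : ((l.map Formula.box : List Formula) : Multiset Formula) ≤ Δ)
    (a : Nonempty (Deriv P (boxtimes Θ) (boxtimes l))) (b : ∀ A ∈ l, P (boxtimes Θ) {A}) :
    Nonempty (Deriv P Γ Δ) := by
  obtain ⟨Γ₀, rfl⟩ := Multiset.le_iff_exists_add.1 hΓ
  obtain ⟨Δ₀, rfl⟩ := Multiset.le_iff_exists_add.1 hΔ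
  rw [add_comm]
  exact a.map fun a => .box Γ₀ Δ₀ Θ l hl a fun i => b _ (l.get_mem i)

end Deriv

/-- The largest set of sequents each of which has a finite derivation whose right premises are
again in the set. -/
def CoProv (Γ Δ : Multiset Formula) : Prop :=
  ∃ P : Multiset Formula → Multiset Formula → Prop,
    (∀ Γ Δ, P Γ Δ → Nonempty (Deriv P Γ Δ)) ∧ P Γ Δ

namespace CoProv

variable {Γ Δ Θ : Multiset Formula} {A : Formula}

theorem nonempty_deriv (h : CoProv Γ Δ) : Nonempty (Deriv CoProv Γ Δ) := by
  obtain ⟨P, hP, h⟩ := h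
  exact (hP _ _ h).elim fun d => d.mono fun _ _ h' => ⟨P, hP, h'⟩

theorem coinduction {P : Multiset Formula → Multiset Formula → Prop}
    (hP : ∀ Γ Δ, P Γ Δ → Nonempty (Deriv (fun Γ Δ => P Γ Δ ∨ CoProv Γ Δ) Γ Δ)) (h : P Γ Δ) :
    CoProv Γ Δ := by
  refine ⟨fun Γ Δ => P Γ Δ ∨ CoProv Γ Δ, fun Γ Δ h => ?_, .inl h⟩
  exact h.elim (hP Γ Δ) fun h => h.nonempty_deriv.elim fun d => d.mono fun _ _ => .inr

theorem of_deriv (d : Nonempty (Deriv CoProv Γ Δ)) : CoProv Γ Δ :=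
  coinduction (P := fun Γ Δ => Nonempty (Deriv CoProv Γ Δ))
    (fun _ _ d => d.elim fun d => d.mono fun _ _ => .inr) d

theorem nonempty_infProof (h : CoProv Γ Δ) : Nonempty (InfProof true Γ Δ) := by
  obtain ⟨P, hP, h⟩ := h
  exact ⟨⟨fun n => Deriv.unravel (fun Γ Δ h => (hP Γ Δ h).some) n Γ Δ h,
    fun n => Deriv.trunc_unravel _ n h⟩⟩

theorem identity (A : Formula) (hΓ : A ∈ Γ) (hΔ : A ∈ Δ) : Nonempty (Deriv CoProv Γ Δ) := by
  induction A generalizing Γ Δ with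
  | atom p =>
    obtain ⟨Γ, rfl⟩ := Multiset.exists_cons_of_mem hΓ
    obtain ⟨Δ, rfl⟩ := Multiset.exists_cons_of_mem hΔ
    exact ⟨.axP Γ Δ p⟩
  | bot =>
    obtain ⟨Γ, rfl⟩ := Multiset.exists_cons_of_mem hΓ
    exact ⟨.axBot Γ Δ⟩
  | imp A B ihA ihB =>
    obtain ⟨Γ, rfl⟩ := Multiset.exists_cons_of_mem hΓ
    obtain ⟨Δ, rfl⟩ := Multiset.exists_cons_of_mem hΔ
    refine Deriv.nonempty_impR ?_
    rw [Multiset.cons_swap]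
    obtain ⟨a⟩ := ihB (Γ := B ::ₘ A ::ₘ Γ) (Δ := B ::ₘ Δ) (by simp) (by simp)
    obtain ⟨b⟩ := ihA (Γ := A ::ₘ Γ) (Δ := A ::ₘ B ::ₘ Δ) (by simp) (by simp)
    exact ⟨.impL _ _ A B a b⟩
  | box A ih =>
    refine Deriv.nonempty_box (Θ := {A}) [A] (by simp) (by simpa using hΓ) (by simpa using hΔ)
      (ih (by simp [boxtimes]) (by simp [boxtimes])) fun B hB => ?_
    obtain rfl := List.mem_singleton.1 hB
    exact of_deriv (ih (by simp [boxtimes]) (by simp))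

/-- The Go rule, stated with an arbitrary context in the conclusion. -/
theorem boxGo (d : CoProv ((A.imp A.box).box ::ₘ boxtimes Θ) {A}) :
    CoProv (Γ + Θ.map Formula.box) (A.box ::ₘ Δ) := by
  set B := A.imp A.box
  let P : Multiset Formula → Multiset Formula → Prop :=
    fun Γ Δ => Γ = boxtimes Θ ∧ (Δ = {A} ∨ Δ = {B})
  let Q : Multiset Formula → Multiset Formula → Prop := fun Γ Δ => P Γ Δ ∨ CoProv Γ Δ
  have lift : ∀ {Γ Δ}, Nonempty (Deriv CoProv Γ Δ) → Nonempty (Deriv Q Γ Δ) :=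
    fun d => d.elim fun d => d.mono fun _ _ => .inr
  have hA : Q (boxtimes Θ) {A} := .inl ⟨rfl, .inl rfl⟩
  have hB' : Q (boxtimes Θ) {B} := .inl ⟨rfl, .inr rfl⟩
  have hΘ : Θ.map Formula.box ≤ boxtimes Θ := Multiset.le_add_left _ _
  have both : ∀ {Γ Δ}, Θ.map Formula.box ≤ Γ → {A.box, B.box} ≤ Δ → Nonempty (Deriv Q Γ Δ) := by
    intro Γ Δ hΓ hΔ
    refine Deriv.nonempty_box [B, A] (by simp) hΓ ?_ ?_ (by simp [hA, hB'])
    · exact hΔ.trans' (Multiset.pair_comm _ _).le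
    · exact Deriv.nonempty_impR (Δ := {A, B.box, A.box})
        (lift (identity A (by simp) (by simp)))
  have boxA : ∀ {Γ Δ}, Θ.map Formula.box ≤ Γ → A.box ∈ Δ → Nonempty (Deriv Q Γ Δ) := by
    intro Γ Δ hΓ hΔ
    refine Deriv.nonempty_box [A] (by simp) hΓ (by simpa using hΔ) ?_ (by simp [hA])
    refine Deriv.nonempty_cut (A := B.box) (both hΘ ?_)
      (Deriv.weaken (lift d.nonempty_deriv) le_rfl ?_)
    · rw [Multiset.pair_comm]
      exact Multiset.cons_le_cons _ (by simp [boxtimes])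
    · simp [boxtimes]
  have closed : ∀ Γ Δ, P Γ Δ → Nonempty (Deriv Q Γ Δ) := by
    rintro Γ Δ ⟨rfl, rfl | rfl⟩
    · refine Deriv.nonempty_cut (A := B.box) ?_ (lift d.nonempty_deriv)
      refine Deriv.nonempty_box [B] (by simp) hΘ (by simp) ?_ (by simp [hB'])
      exact Deriv.nonempty_impR (Δ := {B.box}) (both (hΘ.trans (Multiset.le_cons_self _ _)) le_rfl)
    · exact Deriv.nonempty_impR (Δ := 0) (boxA (hΘ.trans (Multiset.le_cons_self _ _)) (by simp))
  refine of_deriv ?_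
  obtain ⟨e⟩ := boxA (Γ := Γ + Θ.map Formula.box) (Δ := A.box ::ₘ Δ)
    (Multiset.le_add_left _ _) (by simp)
  exact e.mono fun _ _ h => h.elim (coinduction closed) id

theorem of_goSeq {c : Bool} (h : GoSeq c Γ Δ) : CoProv Γ Δ := by
  induction h with
  | ax c Γ Δ A => exact of_deriv (identity A (by simp) (by simp))
  | axBot c Γ Δ => exact of_deriv ⟨.axBot Γ Δ⟩
  | impL c Γ Δ A B _ _ iha ihb =>
    exact of_deriv (iha.nonempty_deriv.elim fun a => ihb.nonempty_deriv.map (.impL Γ Δ A B a))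
  | impR c Γ Δ A B _ ih => exact of_deriv (Deriv.nonempty_impR ih.nonempty_deriv)
  | boxGo c Γ Δ Θ A _ ih => exact boxGo ih
  | cut Γ Δ A _ _ iha ihb =>
    exact of_deriv (Deriv.nonempty_cut iha.nonempty_deriv ihb.nonempty_deriv)

end CoProv

theorem stmt6 (Γ Δ : Multiset Formula) :
    GoSeq true Γ Δ → Nonempty (InfProof true Γ Δ) :=
  fun h => (CoProv.of_goSeq h).nonempty_infProof
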